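/- (Lower bound for every deterministic online algorithm, two machines.) For m = 2 machines in the uniform profit case, for every deterministic online algorithm A there exists an instance σ with OPT(σ) ≥ (6/5) · V_A(σ). (The adversary presents J_1 = [0,1] and J_2 = [2,3]; if A places them on different machines it then presents J_3 = [0,3], and if A places them on the same machine it then presents J_3 = [0,2] followed by J_4 = [1,3].) -/

import Mathlib

open MeasureTheory

/- A job is a pair `(r, d)` of reals with `r < d`, representing the closed
interval `[r, d]`.  An instance on `m` machines is a nonempty finite sequence
`jobs : Fin n → ℝ × ℝ` of such jobs.  A placement is `f : Fin n → Fin m`. -/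

/-- Profit of a placement in the uniform profit case: the sum over machines of
the Lebesgue measure of the union of the intervals of the jobs placed there. -/
noncomputable def profit {n m : ℕ} (jobs : Fin n → ℝ × ℝ) (f : Fin n → Fin m) : ℝ :=
  ∑ a : Fin m,
    (volume (⋃ i : Fin n, ⋃ (_ : f i = a), Set.Icc (jobs i).1 (jobs i).2)).toReal

/-- Optimal offline profit. -/
noncomputable def opt (m : ℕ) {n : ℕ} (jobs : Fin n → ℝ × ℝ) : ℝ :=
  ⨆ f : Fin n → Fin m, profit jobs f

/-- A deterministic online algorithm on `m` machines: a function assigning to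
each (nonempty) finite sequence of jobs a machine.  On an instance it is fed,
for each job `i`, the prefix `J_1, …, J_i`. -/
def inducedPlacement {n : ℕ} (m : ℕ) (A : List (ℝ × ℝ) → Fin m)
    (jobs : Fin n → ℝ × ℝ) : Fin n → Fin m :=
  fun i => A ((List.ofFn jobs).take (i.1 + 1))

/-- The set of times covered by the jobs placed on machine `a`. -/
def covered {n m : ℕ} (jobs : Fin n → ℝ × ℝ) (f : Fin n → Fin m) (a : Fin m) : Set ℝ :=
  ⋃ i : Fin n, ⋃ (_ : f i = a), Set.Icc (jobs i).1 (jobs i).2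

theorem profit_two {n : ℕ} (jobs : Fin n → ℝ × ℝ) (f : Fin n → Fin 2) :
    profit jobs f = volume.real (covered jobs f 0) + volume.real (covered jobs f 1) := by
  simp [profit, covered, Fin.sum_univ_two, Measure.real]

theorem Icc_subset_covered {n m : ℕ} (jobs : Fin n → ℝ × ℝ) (f : Fin n → Fin m) {a : Fin m}
    (i : Fin n) (hi : f i = a) : Set.Icc (jobs i).1 (jobs i).2 ⊆ covered jobs f a :=
  fun _ hx => Set.mem_iUnion₂.2 ⟨i, hi, hx⟩

theorem isCompact_covered {n m : ℕ} (jobs : Fin n → ℝ × ℝ) (f : Fin n → Fin m) (a : Fin m) :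
    IsCompact (covered jobs f a) :=
  isCompact_iUnion fun _ => isCompact_iUnion fun _ => isCompact_Icc

/-- The measure of the covered set is at most the total length of the jobs on the machine. -/
theorem volume_covered_le_sum {n m : ℕ} (jobs : Fin n → ℝ × ℝ) (f : Fin n → Fin m) (a : Fin m)
    (hjobs : ∀ i, (jobs i).1 < (jobs i).2) :
    volume.real (covered jobs f a) ≤ ∑ i, if f i = a then (jobs i).2 - (jobs i).1 else 0 := by
  refine (measureReal_iUnion_fintype_le _).trans (Finset.sum_le_sum fun i _ => ?_)
  by_cases h : f i = a
  · simp [h, (hjobs i).le]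
  · simp [h]

/-- The measure of the covered set is at most the length of an interval containing all jobs. -/
theorem volume_covered_le_of_subset_Icc {n m : ℕ} (jobs : Fin n → ℝ × ℝ) (f : Fin n → Fin m)
    (a : Fin m) {l u : ℝ} (hlu : l ≤ u) (hjobs : ∀ i, l ≤ (jobs i).1 ∧ (jobs i).2 ≤ u) :
    volume.real (covered jobs f a) ≤ u - l := by
  have h : covered jobs f a ⊆ Set.Icc l u :=
    Set.iUnion₂_subset fun i _ => Set.Icc_subset_Icc (hjobs i).1 (hjobs i).2
  simpa [hlu] using measureReal_mono h (μ := volume) measure_Icc_lt_top.ne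

theorem le_volume_covered {n m : ℕ} (jobs : Fin n → ℝ × ℝ) (f : Fin n → Fin m) (a : Fin m)
    {s : Set ℝ} (h : s ⊆ covered jobs f a) : volume.real s ≤ volume.real (covered jobs f a) :=
  measureReal_mono h (isCompact_covered jobs f a).measure_ne_top

theorem profit_le_opt {n m : ℕ} (jobs : Fin n → ℝ × ℝ) (f : Fin n → Fin m) :
    profit jobs f ≤ opt m jobs :=
  le_ciSup (Set.finite_range _).bddAbove f

/-- The adversary's sequence against an algorithm that separates `[0, 1]` and `[2, 3]`. -/
def separatedJobs : Fin 3 → ℝ × ℝ := ![(0, 1), (2, 3), (0, 3)]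

/-- The adversary's sequence against an algorithm that puts `[0, 1]` and `[2, 3]` together. -/
def togetherJobs : Fin 4 → ℝ × ℝ := ![(0, 1), (2, 3), (0, 2), (1, 3)]

@[simp] theorem separatedJobs_zero : separatedJobs 0 = (0, 1) := rfl

@[simp] theorem separatedJobs_one : separatedJobs 1 = (2, 3) := rfl

@[simp] theorem separatedJobs_two : separatedJobs 2 = (0, 3) := rfl

@[simp] theorem togetherJobs_zero : togetherJobs 0 = (0, 1) := rfl

@[simp] theorem togetherJobs_one : togetherJobs 1 = (2, 3) := rfl

@[simp] theorem togetherJobs_two : togetherJobs 2 = (0, 2) := rfl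

@[simp] theorem togetherJobs_three : togetherJobs 3 = (1, 3) := rfl

theorem separatedJobs_lt (i : Fin 3) : (separatedJobs i).1 < (separatedJobs i).2 := by
  fin_cases i <;> norm_num [separatedJobs]

theorem togetherJobs_lt (i : Fin 4) : (togetherJobs i).1 < (togetherJobs i).2 := by
  fin_cases i <;> norm_num [togetherJobs]

theorem five_le_opt_separatedJobs : 5 ≤ opt 2 separatedJobs := by
  obtain ⟨f, f0, f1, f2⟩ : ∃ f : Fin 3 → Fin 2, f 0 = 0 ∧ f 1 = 0 ∧ f 2 = 1 :=
    ⟨![0, 0, 1], rfl, rfl, rfl⟩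
  refine le_trans ?_ (profit_le_opt separatedJobs f)
  rw [profit_two]
  have h0 := le_volume_covered separatedJobs f 0 (Set.union_subset
    (Icc_subset_covered separatedJobs f 0 f0) (Icc_subset_covered separatedJobs f 1 f1))
  have h1 := le_volume_covered separatedJobs f 1 (Icc_subset_covered separatedJobs f 2 f2)
  have hd : Disjoint (Set.Icc (0 : ℝ) 1) (Set.Icc 2 3) :=
    Set.disjoint_left.2 fun x hx hy => by linarith [hx.2, hy.1]
  simp only [separatedJobs_zero, separatedJobs_one, separatedJobs_two] at h0 h1
  rw [measureReal_union hd measurableSet_Icc measure_Icc_lt_top.ne measure_Icc_lt_top.ne] at h0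
  norm_num [Real.volume_real_Icc] at h0 h1
  linarith

theorem six_le_opt_togetherJobs : 6 ≤ opt 2 togetherJobs := by
  obtain ⟨f, f0, f1, f2, f3⟩ :
      ∃ f : Fin 4 → Fin 2, f 0 = 0 ∧ f 1 = 1 ∧ f 2 = 1 ∧ f 3 = 0 :=
    ⟨![0, 1, 1, 0], rfl, rfl, rfl, rfl⟩
  refine le_trans ?_ (profit_le_opt togetherJobs f)
  rw [profit_two]
  have h0 := le_volume_covered togetherJobs f 0 (Set.union_subset
    (Icc_subset_covered togetherJobs f 0 f0) (Icc_subset_covered togetherJobs f 3 f3))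
  have h1 := le_volume_covered togetherJobs f 1 (Set.union_subset
    (Icc_subset_covered togetherJobs f 2 f2) (Icc_subset_covered togetherJobs f 1 f1))
  simp only [togetherJobs_zero, togetherJobs_one, togetherJobs_two, togetherJobs_three] at h0 h1
  rw [Set.Icc_union_Icc_eq_Icc (by norm_num) (by norm_num)] at h0 h1
  norm_num [Real.volume_real_Icc] at h0 h1
  linarith

theorem profit_separatedJobs_le (f : Fin 3 → Fin 2) (hf : f 0 ≠ f 1) :
    profit separatedJobs f ≤ 4 := by
  rw [profit_two]
  have sum_bound := fun a => volume_covered_le_sum separatedJobs f a separatedJobs_lt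
  have span_bound := fun a => volume_covered_le_of_subset_Icc separatedJobs f a
    (l := 0) (u := 3) (by norm_num) (fun i => by fin_cases i <;> norm_num [separatedJobs])
  have s0 := sum_bound 0
  have s1 := sum_bound 1
  have I0 := span_bound 0
  have I1 := span_bound 1
  simp only [Fin.sum_univ_three] at s0 s1
  generalize volume.real (covered separatedJobs f 0) = v at *
  generalize volume.real (covered separatedJobs f 1) = w at *
  rcases (by omega : f 0 = 0 ∨ f 0 = 1) with h0 | h0 <;>
  rcases (by omega : f 1 = 0 ∨ f 1 = 1) with h1 | h1 <;>
  rcases (by omega : f 2 = 0 ∨ f 2 = 1) with h2 | h2 <;>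
    first
    | exact absurd (h0.trans h1.symm) hf
    | norm_num [h0, h1, h2] at s0 s1 I0 I1
      linarith

theorem profit_togetherJobs_le (f : Fin 4 → Fin 2) (hf : f 0 = f 1) :
    profit togetherJobs f ≤ 5 := by
  rw [profit_two]
  have sum_bound := fun a => volume_covered_le_sum togetherJobs f a togetherJobs_lt
  have span_bound := fun a => volume_covered_le_of_subset_Icc togetherJobs f a
    (l := 0) (u := 3) (by norm_num) (fun i => by fin_cases i <;> norm_num [togetherJobs])
  have s0 := sum_bound 0
  have s1 := sum_bound 1
  have I0 := span_bound 0
  have I1 := span_bound 1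
  simp only [Fin.sum_univ_four, ← hf] at s0 s1
  generalize volume.real (covered togetherJobs f 0) = v at *
  generalize volume.real (covered togetherJobs f 1) = w at *
  rcases (by omega : f 0 = 0 ∨ f 0 = 1) with h0 | h0 <;>
  rcases (by omega : f 2 = 0 ∨ f 2 = 1) with h2 | h2 <;>
  rcases (by omega : f 3 = 0 ∨ f 3 = 1) with h3 | h3 <;>
    norm_num [h0, h2, h3] at s0 s1 I0 I1 <;> linarith

/-- Lower bound for every deterministic online algorithm on two machines:
there is an instance with `OPT(σ) ≥ (6/5) · V_A(σ)`. -/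
theorem online_lower_bound_two_machines (A : List (ℝ × ℝ) → Fin 2) :
    ∃ (n : ℕ), 0 < n ∧ ∃ jobs : Fin n → ℝ × ℝ,
      (∀ i, (jobs i).1 < (jobs i).2) ∧
      (6 / 5) * profit jobs (inducedPlacement 2 A jobs) ≤ opt 2 jobs := by
  by_cases h : A [(0, 1)] = A [(0, 1), (2, 3)]
  · refine ⟨4, by norm_num, togetherJobs, togetherJobs_lt, ?_⟩
    have := profit_togetherJobs_le (inducedPlacement 2 A togetherJobs)
      (by simpa [inducedPlacement, togetherJobs] using h)
    linarith [six_le_opt_togetherJobs]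
  · refine ⟨3, by norm_num, separatedJobs, separatedJobs_lt, ?_⟩
    have := profit_separatedJobs_le (inducedPlacement 2 A separatedJobs)
      (by simpa [inducedPlacement, separatedJobs] using h)
    linarith [five_le_opt_separatedJobs]
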